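/- arXiv:1503.03879 — 3 statements merged into one kernel-verified Lean document; each statement's English description precedes it below -/
import Mathlib

section
/- Let Σ be a symmetric positive definite real matrix indexed by V×V. Let a, c ∈ V be distinct with Σ_{ac} = 0, let B ⊆ V \ {a, c}, and let z ∈ V \ (B ∪ {a, c}). Suppose there exists x ∈ V \ (B ∪ {a, c, z}) such that σ_{uw|{x}} = 0 for every u ∈ {a, c} and every w ∈ B ∪ {z} (i.e., {a,c} ⟂⟂ {z} ∪ B | x). Then ρ²_{ac|B} ≤ ρ²_{ac|B∪{z}}. -/
open Matrix

variable {V : Type*}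

/-- Partial covariance `σ_{uv|Z} = Σ_{uv} − Σ_{uZ} (Σ_{ZZ})⁻¹ Σ_{Zv}`. -/
noncomputable def pcov [Fintype V] [DecidableEq V] (S : Matrix V V ℝ) (u v : V) (Z : Finset V) : ℝ :=
  S u v - ∑ i : {x // x ∈ Z}, ∑ j : {x // x ∈ Z},
    S u (i : V) * (Matrix.of (fun i j : {x // x ∈ Z} => S (i : V) (j : V)))⁻¹ i j * S (j : V) v

/-- Squared partial correlation `ρ²_{uv|Z}`. -/
noncomputable def rho2 [Fintype V] [DecidableEq V] (S : Matrix V V ℝ) (u v : V) (Z : Finset V) : ℝ :=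
  pcov S u v Z ^ 2 / (pcov S u u Z * pcov S v v Z)

/-- The quadratic form `b_Zᵀ (S_ZZ)⁻¹ b_Z`. -/
noncomputable def invQuadForm [DecidableEq V] (S : Matrix V V ℝ) (b : V → ℝ) (Z : Finset V) : ℝ :=
  ∑ i : {x // x ∈ Z}, ∑ j : {x // x ∈ Z},
    b (i : V) * (Matrix.of (fun i j : {x // x ∈ Z} => S (i : V) (j : V)))⁻¹ i j * b (j : V)

/-- The linear system `S_ZZ y_Z = b_Z`, with the solution extended by zero to all of `V`. -/
theorem Matrix.PosDef.exists_solution_supported [Fintype V] [DecidableEq V] {S : Matrix V V ℝ}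
    (hS : S.PosDef) (Z : Finset V) (b : V → ℝ) :
    ∃ y : V → ℝ, (∀ i ∉ Z, y i = 0) ∧ (∀ i ∈ Z, (S *ᵥ y) i = b i) ∧
      ∀ d : V → ℝ, ∑ i : {x // x ∈ Z}, ∑ j : {x // x ∈ Z},
        d (i : V) * (Matrix.of (fun i j : {x // x ∈ Z} => S (i : V) (j : V)))⁻¹ i j * b (j : V)
          = d ⬝ᵥ y := by
  set A : Matrix {x // x ∈ Z} {x // x ∈ Z} ℝ :=
    Matrix.of (fun i j : {x // x ∈ Z} => S (i : V) (j : V)) with hA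
  have hApd : A.PosDef := hS.submatrix (e := fun i : {x // x ∈ Z} => (i : V))
    Subtype.val_injective
  have hdet : IsUnit A.det := hApd.det_pos.ne'.isUnit
  set w : {x // x ∈ Z} → ℝ := A⁻¹ *ᵥ fun j : {x // x ∈ Z} => b (j : V) with hw
  have hAw : A *ᵥ w = fun j : {x // x ∈ Z} => b (j : V) := by
    rw [hw, Matrix.mulVec_mulVec, Matrix.mul_nonsing_inv _ hdet, Matrix.one_mulVec]
  set y : V → ℝ := fun i => if h : i ∈ Z then w ⟨i, h⟩ else 0 with hy
  have hsum (d : V → ℝ) : d ⬝ᵥ y = ∑ i : {x // x ∈ Z}, d i * w i := by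
    rw [dotProduct, ← Finset.sum_subset (Finset.subset_univ Z), ← Finset.sum_coe_sort]
    · exact Finset.sum_congr rfl fun i _ => by simp [hy]
    · intro i _ hi
      simp [hy, hi]
  refine ⟨y, fun i hi => by simp [hy, hi], fun i hi => ?_, fun d => ?_⟩
  · rw [Matrix.mulVec, hsum]
    exact congrFun hAw ⟨i, hi⟩
  · rw [hsum]
    refine Finset.sum_congr rfl fun i _ => ?_
    simp only [hw, Matrix.mulVec, dotProduct, Finset.mul_sum, mul_assoc]

/-- Vectors supported on `Z` pair with `f` as with any `g` agreeing with `f` on `Z`. -/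
theorem dotProduct_eq_of_eqOn_support [Fintype V] {Z : Finset V} {y f g : V → ℝ}
    (hy : ∀ i ∉ Z, y i = 0) (hfg : ∀ i ∈ Z, f i = g i) : y ⬝ᵥ f = y ⬝ᵥ g := by
  refine Finset.sum_congr rfl fun i _ => ?_
  by_cases hi : i ∈ Z
  · rw [hfg i hi]
  · simp [hy i hi]

theorem Matrix.IsSymm.dotProduct_mulVec_comm [Fintype V] {S : Matrix V V ℝ} (hS : S.IsSymm)
    (v w : V → ℝ) : v ⬝ᵥ S *ᵥ w = w ⬝ᵥ S *ᵥ v := by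
  rw [Matrix.dotProduct_mulVec, ← Matrix.mulVec_transpose, hS.eq, dotProduct_comm]

theorem invQuadForm_mono [Fintype V] [DecidableEq V] {S : Matrix V V ℝ} (hsym : S.IsSymm)
    (hS : S.PosDef) (b : V → ℝ) {Z Z' : Finset V} (h : Z ⊆ Z') :
    invQuadForm S b Z ≤ invQuadForm S b Z' := by
  obtain ⟨y, hy0, hy, hyq⟩ := hS.exists_solution_supported Z b
  obtain ⟨y', hy0', hy', hyq'⟩ := hS.exists_solution_supported Z' b
  rw [invQuadForm, invQuadForm, hyq, hyq', dotProduct_comm b y, dotProduct_comm b y']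
  have h1 : y ⬝ᵥ S *ᵥ y = y ⬝ᵥ b := dotProduct_eq_of_eqOn_support hy0 hy
  have h2 : y ⬝ᵥ S *ᵥ y' = y ⬝ᵥ b :=
    dotProduct_eq_of_eqOn_support hy0 fun i hi => hy' i (h hi)
  have h3 : y' ⬝ᵥ S *ᵥ y' = y' ⬝ᵥ b := dotProduct_eq_of_eqOn_support hy0' hy'
  have h4 := hsym.dotProduct_mulVec_comm y' y
  have hnn := hS.posSemidef.dotProduct_mulVec_nonneg (y' - y)
  simp only [star_trivial, Matrix.mulVec_sub, dotProduct_sub, sub_dotProduct] at hnn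
  linarith

theorem invQuadForm_nonneg [Fintype V] [DecidableEq V] {S : Matrix V V ℝ} (hsym : S.IsSymm)
    (hS : S.PosDef) (b : V → ℝ) (Z : Finset V) : 0 ≤ invQuadForm S b Z := by
  simpa [invQuadForm] using invQuadForm_mono hsym hS b Z.empty_subset

theorem pcov_self_pos [Fintype V] [DecidableEq V] {S : Matrix V V ℝ} (hsym : S.IsSymm)
    (hS : S.PosDef) {u : V} {Z : Finset V} (hu : u ∉ Z) : 0 < pcov S u u Z := by
  obtain ⟨y, hy0, hy, hyq⟩ := hS.exists_solution_supported Z fun i => S i u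
  have hq := hyq (S u)
  rw [pcov, hq]
  have h1 : y ⬝ᵥ S *ᵥ y = y ⬝ᵥ S.col u := dotProduct_eq_of_eqOn_support hy0 hy
  have h2 : S.col u = S u := funext fun i => hsym.apply u i
  have hne : Pi.single u 1 - y ≠ 0 := fun h0 => by
    simpa [hy0 u hu] using congrFun h0 u
  have hpos := hS.dotProduct_mulVec_pos hne
  simp only [star_trivial, Matrix.mulVec_sub, dotProduct_sub, sub_dotProduct,
    Matrix.mulVec_single_one, single_one_dotProduct, h1, h2] at hpos
  have h3 : (S *ᵥ y) u = S u ⬝ᵥ y := rfl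
  rw [h3, dotProduct_comm y] at hpos
  linarith

theorem pcov_singleton_eq_zero [Fintype V] [DecidableEq V] {S : Matrix V V ℝ}
    (hS : S.PosDef) {u w x : V} (h : pcov S u w {x} = 0) : S u w = S u x / S x x * S x w := by
  obtain ⟨y, hy0, hy, hyq⟩ := hS.exists_solution_supported {x} fun i => S i w
  have hsupp (d : V → ℝ) : d ⬝ᵥ y = d x * y x :=
    Finset.sum_eq_single x (fun i _ hi => by simp [hy0 i (by simpa using hi)]) (by simp)
  have hx : S x x * y x = S x w := by
    rw [← hsupp]
    exact hy x (by simp)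
  rw [pcov, hyq (S u), hsupp] at h
  have hxx : S x x ≠ 0 := hS.diag_pos.ne'
  rw [← hx]
  field_simp
  linarith

theorem pcov_eq_of_factor [Fintype V] [DecidableEq V] {S : Matrix V V ℝ} (hsym : S.IsSymm)
    {u v : V} {Z : Finset V} {b : V → ℝ} {s t : ℝ} (hu : ∀ i ∈ Z, S u i = s * b i)
    (hv : ∀ i ∈ Z, S v i = t * b i) : pcov S u v Z = S u v - s * t * invQuadForm S b Z := by
  rw [pcov, invQuadForm, Finset.mul_sum]
  congr 1
  refine Finset.sum_congr rfl fun i _ => ?_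
  rw [Finset.mul_sum]
  refine Finset.sum_congr rfl fun j _ => ?_
  rw [hu i i.2, ← hsym.apply j v, hv j j.2]
  ring

/-- Theorem 3, part 1: if `a ⟂⟂ c` and `{a,c} ⟂⟂ {z} ∪ B | x`
for some `x ∉ B ∪ {a,c,z}`, then `ρ²_{ac|B} ≤ ρ²_{ac|B∪{z}}`. -/
theorem stmt_3 [Fintype V] [DecidableEq V] [Nonempty V]
    (S : Matrix V V ℝ) (hsym : S.IsSymm) (hpd : S.PosDef)
    (a c : V) (hac : a ≠ c) (hSac : S a c = 0)
    (B : Finset V) (haB : a ∉ B) (hcB : c ∉ B)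
    (z : V) (hzB : z ∉ B) (hza : z ≠ a) (hzc : z ≠ c)
    (h : ∃ x : V, x ∉ B ∧ x ≠ a ∧ x ≠ c ∧ x ≠ z ∧
      ∀ u ∈ ({a, c} : Finset V), ∀ w ∈ insert z B, pcov S u w {x} = 0) :
    rho2 S a c B ≤ rho2 S a c (insert z B) := by
  obtain ⟨x, -, -, -, -, hx⟩ := h
  have ha : ∀ i ∈ insert z B, S a i = S a x / S x x * S x i := fun i hi =>
    pcov_singleton_eq_zero hpd (hx a (by simp) i hi)
  have hc : ∀ i ∈ insert z B, S c i = S c x / S x x * S x i := fun i hi =>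
    pcov_singleton_eq_zero hpd (hx c (by simp) i hi)
  have hsub : B ⊆ insert z B := Finset.subset_insert z B
  have haB' : ∀ i ∈ B, S a i = S a x / S x x * S x i := fun i hi => ha i (hsub hi)
  have hcB' : ∀ i ∈ B, S c i = S c x / S x x * S x i := fun i hi => hc i (hsub hi)
  have hq0 := invQuadForm_nonneg hsym hpd (S x) B
  have hq := invQuadForm_mono hsym hpd (S x) hsub
  have hapos : 0 < pcov S a a (insert z B) := pcov_self_pos hsym hpd (by simp [haB, hza.symm])
  have hcpos : 0 < pcov S c c (insert z B) := pcov_self_pos hsym hpd (by simp [hcB, hzc.symm])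
  rw [pcov_eq_of_factor hsym ha ha] at hapos
  rw [pcov_eq_of_factor hsym hc hc] at hcpos
  rw [rho2, rho2, pcov_eq_of_factor hsym ha hc, pcov_eq_of_factor hsym ha ha,
    pcov_eq_of_factor hsym hc hc, pcov_eq_of_factor hsym haB' hcB',
    pcov_eq_of_factor hsym haB' haB', pcov_eq_of_factor hsym hcB' hcB', hSac]
  have hmul (s : ℝ) := mul_le_mul_of_nonneg_left hq (mul_self_nonneg s)
  refine div_le_div₀ (sq_nonneg _) ?_ (mul_pos hapos hcpos) ?_
  · rw [zero_sub, zero_sub, neg_sq, neg_sq, mul_pow, mul_pow _ (invQuadForm _ _ (insert z B))]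
    exact mul_le_mul_of_nonneg_left (pow_le_pow_left₀ hq0 hq 2) (sq_nonneg _)
  · refine mul_le_mul ?_ ?_ hcpos.le ?_ <;>
      linarith [hmul (S a x / S x x), hmul (S c x / S x x)]
end

section
/- Let Σ be a symmetric positive definite real matrix indexed by V×V and let a, c, z, z' ∈ V be distinct. (1) If Σ_{ac} = 0, Σ_{az} = 0, Σ_{cz} = 0, σ_{az'|{z}} = 0 and σ_{cz'|{z}} = 0, then ρ²_{ac|{z}} = ρ²_{ac|{z'}} = ρ²_{ac} = 0. (2) If Σ_{az} = 0, there exists x ∈ V \ {a, c, z, z'} with σ_{ac|{x}} = 0 and σ_{zc|{x}} = 0, and moreover σ_{az'|{z}} = 0 and σ_{cz'|{z}} = 0, then ρ²_{ac|{z}} ≥ ρ²_{ac|{z'}} ≥ ρ²_{ac}. -/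
open Matrix

variable {V : Type*}

theorem pcov_empty [Fintype V] [DecidableEq V] (S : Matrix V V ℝ) (u v : V) :
    pcov S u v ∅ = S u v := by
  have : IsEmpty {x : V // x ∈ (∅ : Finset V)} := ⟨fun x => Finset.notMem_empty _ x.2⟩
  simp [pcov]

theorem pcov_singleton [Fintype V] [DecidableEq V] (S : Matrix V V ℝ) (u v w : V) :
    pcov S u v {w} = S u v - S u w * S w v / S w w := by
  let _ : Unique {x : V // x ∈ ({w} : Finset V)} :=
    ⟨⟨⟨w, by simp⟩⟩, fun x => Subtype.ext (Finset.mem_singleton.1 x.2)⟩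
  have hw : ((default : {x : V // x ∈ ({w} : Finset V)}) : V) = w := rfl
  rw [pcov, Fintype.sum_unique, Fintype.sum_unique, Matrix.inv_subsingleton]
  simp only [Matrix.diagonal_apply_eq, Matrix.of_apply, hw, Ring.inverse_eq_inv']
  ring

theorem Matrix.PosDef.sq_lt_mul_diag {S : Matrix V V ℝ} (hS : S.PosDef) {i j : V} (hij : i ≠ j) :
    S i j ^ 2 < S i i * S j j := by
  have hinj : Function.Injective ![i, j] := by
    intro p q
    fin_cases p <;> fin_cases q <;> simp [hij, hij.symm]
  have h := (hS.submatrix hinj).det_pos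
  have hs : S j i = S i j := by simpa using hS.isHermitian.apply i j
  simp only [Matrix.det_fin_two, Matrix.submatrix_apply, Matrix.cons_val_zero,
    Matrix.cons_val_one, hs] at h
  nlinarith

/-- Corollary 1: with `B = ∅`; part (1) under Theorem 4 (i)-type
hypotheses all three squared partial correlations vanish; part (2) under
Theorem 4 (ii)-type hypotheses `ρ²_{ac|z} ≥ ρ²_{ac|z'} ≥ ρ²_{ac}`. -/
theorem stmt_9 [Fintype V] [DecidableEq V] [Nonempty V]
    (S : Matrix V V ℝ) (hsym : S.IsSymm) (hpd : S.PosDef)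
    (a c z z' : V) (hac : a ≠ c) (haz : a ≠ z) (hcz : c ≠ z)
    (haz' : a ≠ z') (hcz' : c ≠ z') (hzz' : z ≠ z') :
    ((S a c = 0 → S a z = 0 → S c z = 0 →
        pcov S a z' {z} = 0 → pcov S c z' {z} = 0 →
        rho2 S a c {z} = 0 ∧ rho2 S a c {z'} = 0 ∧ rho2 S a c ∅ = 0) ∧
     (S a z = 0 →
        (∃ x : V, x ≠ a ∧ x ≠ c ∧ x ≠ z ∧ x ≠ z' ∧
          pcov S a c {x} = 0 ∧ pcov S z c {x} = 0) →
        pcov S a z' {z} = 0 → pcov S c z' {z} = 0 →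
        rho2 S a c {z'} ≤ rho2 S a c {z} ∧ rho2 S a c ∅ ≤ rho2 S a c {z'})) := by
  have ha := hpd.diag_pos (i := a)
  have hz := hpd.diag_pos (i := z)
  have hz' := hpd.diag_pos (i := z')
  have hza := hsym.apply a z
  have hzc := hsym.apply c z
  have hz'a := hsym.apply a z'
  have hz'c := hsym.apply c z'
  simp only [rho2, pcov_singleton, pcov_empty, hza, hzc, hz'a, hz'c]
  constructor
  · intro h1 h2 h3 h4 h5
    have h4' : S a z' = 0 := by simpa [h2] using h4
    simp [h1, h2, h4']
  · intro h2 _ h4 h5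
    have h4' : S a z' = 0 := by simpa [h2] using h4
    have h5' : S c z' = S c z * S z z' / S z z := by linarith
    have hlt : S c z * S c z / S z z < S c c := by
      rw [div_lt_iff₀ hz]
      nlinarith [hpd.sq_lt_mul_diag hcz]
    have hle : S c z' * S c z' / S z' z' ≤ S c z * S c z / S z z := by
      have hq : S z z' ^ 2 / (S z z * S z' z') ≤ 1 :=
        (div_le_one (mul_pos hz hz')).2 (hpd.sq_lt_mul_diag hzz').le
      calc S c z' * S c z' / S z' z'
          = S c z * S c z / S z z * (S z z' ^ 2 / (S z z * S z' z')) := by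
            rw [h5']
            field_simp
        _ ≤ S c z * S c z / S z z :=
            mul_le_of_le_one_right (div_nonneg (mul_self_nonneg _) hz.le) hq
    have hnn : 0 ≤ S c z' * S c z' / S z' z' := div_nonneg (mul_self_nonneg _) hz'.le
    simp only [h2, h4', zero_mul, zero_div, sub_zero]
    constructor
    · exact div_le_div_of_nonneg_left (sq_nonneg _) (mul_pos ha (by linarith))
        (mul_le_mul_of_nonneg_left (by linarith) ha.le)
    · exact div_le_div_of_nonneg_left (sq_nonneg _) (mul_pos ha (by linarith))
        (mul_le_mul_of_nonneg_left (by linarith) ha.le)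
end

section
/- Let G be a tree with vertex set V and let Σ be a symmetric positive definite real matrix indexed by V×V that is Markov with respect to G. Let a, c, c' ∈ V be distinct with c ∈ path(a, c'). Then for every Z ⊆ V \ {a, c, c'}, ρ²_{ac'|Z} ≤ ρ²_{ac|Z}. -/
open Matrix

variable {V : Type*}

/-- `S` separates `A` from `C` in `G`: every path in `G` from a vertex of `A`
to a vertex of `C` contains a vertex of `S`. -/
def Separates {W : Type*} (G : SimpleGraph W) (A C S : Set W) : Prop :=
  ∀ ⦃a⦄, a ∈ A → ∀ ⦃c⦄, c ∈ C → ∀ p : G.Walk a c, p.IsPath → ∃ s ∈ S, s ∈ p.support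

/-- `v` lies on the (unique, for a tree) path joining `x` and `y` in `G`. -/
def OnPath {W : Type*} (G : SimpleGraph W) (x y v : W) : Prop :=
  ∃ p : G.Walk x y, p.IsPath ∧ v ∈ p.support

/-- `Σ` is Markov with respect to `G`: separation implies vanishing partial covariance. -/
def MarkovTree [Fintype V] [DecidableEq V] (G : SimpleGraph V) (S : Matrix V V ℝ) : Prop :=
  ∀ u v : V, u ≠ v → ∀ Z : Finset V, u ∉ Z → v ∉ Z →
    Separates G {u} {v} (↑Z : Set V) → pcov S u v Z = 0

/-- `r` is the coefficient vector of the residual of the `u`-th variable after linear regression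
on the variables in `Z`. -/
structure IsResidual [Fintype V] [DecidableEq V] (S : Matrix V V ℝ) (Z : Finset V) (u : V)
    (r : V → ℝ) : Prop where
  eq_single : ∀ i ∉ Z, r i = (Pi.single u 1 : V → ℝ) i
  vecMul_eq_zero : ∀ j ∈ Z, (r ᵥ* S) j = 0

section Residual

variable [DecidableEq V] {S : Matrix V V ℝ} {Z : Finset V} {u v c : V}

theorem isUnit_det_restrict (hpd : S.PosDef) (Z : Finset V) :
    IsUnit (Matrix.of fun i j : {x // x ∈ Z} => S i j).det :=
  (hpd.submatrix (e := ((↑) : {x // x ∈ Z} → V)) Subtype.val_injective).det_pos.ne'.isUnit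

variable [Fintype V]

theorem IsResidual.pcov_eq (hpd : S.PosDef) {r : V → ℝ} (hr : IsResidual S Z u r) (v : V) :
    pcov S u v Z = (r ᵥ* S) v := by
  set A : Matrix {x // x ∈ Z} {x // x ∈ Z} ℝ := Matrix.of fun i j => S i j
  set w : {x // x ∈ Z} → ℝ := fun i => (Pi.single u 1 : V → ℝ) i - r i
  have split (j : V) : (r ᵥ* S) j = S u j - ∑ i : {x // x ∈ Z}, w i * S i j := by
    have h : S u j = ∑ i, (Pi.single u 1 : V → ℝ) i * S i j := by simp [Pi.single_apply]
    have h' : ∑ i : {x // x ∈ Z}, w i * S i j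
        = ∑ i, ((Pi.single u 1 : V → ℝ) i - r i) * S i j := by
      rw [Finset.sum_coe_sort Z fun i => ((Pi.single u 1 : V → ℝ) i - r i) * S i j]
      refine Finset.sum_subset (Finset.subset_univ Z) fun i _ hi => ?_
      rw [hr.eq_single i hi, sub_self, zero_mul]
    rw [h, h', ← Finset.sum_sub_distrib]
    exact Finset.sum_congr rfl fun i _ => by ring
  have row (j : {x // x ∈ Z}) : S u j = (w ᵥ* A) j := by
    have := hr.vecMul_eq_zero j j.2
    rw [split, sub_eq_zero] at this
    exact this
  rw [split, pcov, Finset.sum_comm]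
  congr 1
  refine Finset.sum_congr rfl fun j _ => ?_
  rw [← Finset.sum_mul]
  congr 1
  simp_rw [row]
  change ((w ᵥ* A) ᵥ* A⁻¹) j = w j
  rw [vecMul_vecMul, mul_nonsing_inv _ (isUnit_det_restrict hpd Z), vecMul_one]

theorem exists_isResidual (hpd : S.PosDef) (Z : Finset V) (u : V) :
    ∃ r, IsResidual S Z u r := by
  set A : Matrix {x // x ∈ Z} {x // x ∈ Z} ℝ := Matrix.of fun i j => S i j
  set w : {x // x ∈ Z} → ℝ := (fun j : {x // x ∈ Z} => S u j) ᵥ* A⁻¹ with hw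
  have hwA : w ᵥ* A = fun j : {x // x ∈ Z} => S u j := by
    rw [hw, vecMul_vecMul, nonsing_inv_mul _ (isUnit_det_restrict hpd Z), vecMul_one]
  set x : V → ℝ := fun i => if h : i ∈ Z then w ⟨i, h⟩ else 0 with hx
  refine ⟨Pi.single u 1 - x, fun i hi => by simp [hx, hi], fun j hj => ?_⟩
  have hxS : (x ᵥ* S) j = (w ᵥ* A) ⟨j, hj⟩ := by
    change ∑ i, x i * S i j = ∑ i : {x // x ∈ Z}, w i * S i j
    rw [← Finset.sum_subset (Finset.subset_univ Z) fun i _ hi => by simp [hx, hi],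
      ← Finset.sum_coe_sort Z]
    exact Finset.sum_congr rfl fun i _ => by simp [hx]
  rw [sub_vecMul, Pi.sub_apply, hxS, hwA]
  simp

theorem IsResidual.pcov_eq_dotProduct (hpd : S.PosDef) {r s : V → ℝ}
    (hr : IsResidual S Z u r) (hs : IsResidual S Z v s) :
    pcov S u v Z = (r ᵥ* S) ⬝ᵥ s := by
  rw [hr.pcov_eq hpd, ← dotProduct_single_one (r ᵥ* S) v]
  refine Finset.sum_congr rfl fun i _ => ?_
  by_cases hi : i ∈ Z
  · simp [hr.vecMul_eq_zero i hi]
  · rw [hs.eq_single i hi]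

theorem pcov_comm (hsym : S.IsSymm) (hpd : S.PosDef) (u v : V) (Z : Finset V) :
    pcov S u v Z = pcov S v u Z := by
  obtain ⟨r, hr⟩ := exists_isResidual hpd Z u
  obtain ⟨s, hs⟩ := exists_isResidual hpd Z v
  rw [hr.pcov_eq_dotProduct hpd hs, hs.pcov_eq_dotProduct hpd hr, ← dotProduct_mulVec,
    dotProduct_comm, ← vecMul_transpose, hsym.eq]

theorem pcov_self_pos_s13 (hpd : S.PosDef) (hu : u ∉ Z) : 0 < pcov S u u Z := by
  obtain ⟨r, hr⟩ := exists_isResidual hpd Z u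
  have hr0 : r ≠ 0 := fun h => by simpa [h] using hr.eq_single u hu
  rw [hr.pcov_eq_dotProduct hpd hr, ← dotProduct_mulVec]
  simpa using hpd.dotProduct_mulVec_pos hr0

/-- Recursion for partial covariances: conditioning on one further variable `c`. -/
theorem pcov_insert (hpd : S.PosDef) (hc : c ∉ Z) (u v : V) :
    pcov S u v (insert c Z) = pcov S u v Z - pcov S u c Z / pcov S c c Z * pcov S c v Z := by
  obtain ⟨r, hr⟩ := exists_isResidual hpd Z u
  obtain ⟨s, hs⟩ := exists_isResidual hpd Z c
  set t := pcov S u c Z / pcov S c c Z with ht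
  have apply_eq (j : V) : ((r - t • s) ᵥ* S) j = pcov S u j Z - t * pcov S c j Z := by
    simp [sub_vecMul, smul_vecMul, hr.pcov_eq hpd, hs.pcov_eq hpd]
  have hres : IsResidual S (insert c Z) u (r - t • s) := by
    refine ⟨fun i hi => ?_, fun j hj => ?_⟩
    · obtain ⟨hic, hiZ⟩ := not_or.mp (Finset.mem_insert.not.mp hi)
      simp [hr.eq_single i hiZ, hs.eq_single i hiZ, Pi.single_apply, hic]
    · rw [apply_eq]
      rcases Finset.mem_insert.mp hj with rfl | hjZ
      · rw [ht, div_mul_cancel₀ _ (pcov_self_pos_s13 hpd hc).ne', sub_self]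
      · rw [hr.pcov_eq hpd, hs.pcov_eq hpd, hr.vecMul_eq_zero j hjZ, hs.vecMul_eq_zero j hjZ]
        simp
  rw [hres.pcov_eq hpd, apply_eq]

theorem rho2_le_rho2_of_pcov_insert_eq_zero (hsym : S.IsSymm) (hpd : S.PosDef)
    (hu : u ∉ Z) (hc : c ∉ Z) (hv : v ∉ Z) (hcv : c ≠ v) (h : pcov S u v (insert c Z) = 0) :
    rho2 S u v Z ≤ rho2 S u c Z := by
  have hU := pcov_self_pos_s13 hpd hu
  have hC := pcov_self_pos_s13 hpd hc
  have hV := pcov_self_pos_s13 hpd hv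
  have hV' : 0 < pcov S v v (insert c Z) :=
    pcov_self_pos_s13 hpd (by simp [hcv.symm, hv])
  rw [pcov_insert hpd hc, sub_eq_zero] at h
  rw [pcov_insert hpd hc, pcov_comm hsym hpd v c] at hV'
  have hcs : pcov S c v Z ^ 2 ≤ pcov S c c Z * pcov S v v Z := by
    have := mul_pos hC hV'
    field_simp at this
    linarith
  rw [rho2, rho2, h, div_le_div_iff₀ (by positivity) (by positivity)]
  calc (pcov S u c Z / pcov S c c Z * pcov S c v Z) ^ 2 * (pcov S u u Z * pcov S c c Z)
      = pcov S u c Z ^ 2 * pcov S u u Z / pcov S c c Z * pcov S c v Z ^ 2 := by field_simp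
    _ ≤ pcov S u c Z ^ 2 * pcov S u u Z / pcov S c c Z * (pcov S c c Z * pcov S v v Z) := by
        gcongr
    _ = pcov S u c Z ^ 2 * (pcov S u u Z * pcov S v v Z) := by field_simp

end Residual

theorem SimpleGraph.IsTree.separates_of_onPath {G : SimpleGraph V} (hG : G.IsTree) {a b c : V}
    (h : OnPath G a b c) {T : Set V} (hc : c ∈ T) : Separates G {a} {b} T := by
  rintro _ rfl _ rfl p hp
  obtain ⟨q, hq, hcq⟩ := h
  have hpq : p = q := congrArg Subtype.val
    ((hG.isAcyclic.subsingleton_path _ _).elim ⟨p, hp⟩ ⟨q, hq⟩)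
  exact ⟨c, hc, hpq ▸ hcq⟩

/-- Theorem 6: on a Gaussian tree, if `c` lies on the path joining
`a` and `c'`, then `ρ²_{ac'|Z} ≤ ρ²_{ac|Z}` for every `Z ⊆ V \ {a,c,c'}`. -/
theorem stmt_13 [Fintype V] [DecidableEq V] [Nonempty V]
    (G : SimpleGraph V) (hG : G.IsTree)
    (S : Matrix V V ℝ) (hsym : S.IsSymm) (hpd : S.PosDef) (hM : MarkovTree G S)
    (a c c' : V) (hac : a ≠ c) (hac' : a ≠ c') (hcc' : c ≠ c')
    (hpath : OnPath G a c' c) :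
    ∀ Z : Finset V, a ∉ Z → c ∉ Z → c' ∉ Z →
      rho2 S a c' Z ≤ rho2 S a c Z := by
  intro Z ha hc hc'
  refine rho2_le_rho2_of_pcov_insert_eq_zero hsym hpd ha hc hc' hcc' ?_
  exact hM a c' hac' _ (by simp [hac, ha]) (by simp [hcc'.symm, hc'])
    (hG.separates_of_onPath hpath (by simp))
end
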